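/- arXiv:2207.09786 — 2 statements merged into one kernel-verified Lean document; each statement's English description precedes it below -/
import Mathlib

section
/- Let q be a strictly positive probability density on ℝ^d × ℝ^d (with respect to Lebesgue measure) for a pair of random variables (x₀, x_t), with marginal density q(x_t) = ∫ q(x₀, x_t) dx₀ and conditional density q(x_t | x₀) = q(x₀, x_t) / q(x₀) where q(x₀) = ∫ q(x₀, x_t) dx_t. Assume q(x₀, x_t) is continuously differentiable in x_t, that differentiation under the integral sign is valid (∇_{x_t} q(x_t) = ∫ ∇_{x_t} q(x₀, x_t) dx₀), and that ‖∇_{x_t} ln q(x_t|x₀)‖² and ‖∇_{x_t} ln q(x_t)‖² are integrable against q. Then for every measurable ψ : ℝ^d → ℝ^d with E_{x_t ∼ q(x_t)}[‖ψ(x_t)‖²] < ∞, E_{(x₀,x_t) ∼ q}[‖∇_{x_t} ln q(x_t|x₀) − ψ(x_t)‖²] = E_{x_t ∼ q(x_t)}[‖∇_{x_t} ln q(x_t) − ψ(x_t)‖²] + C, where C = E_{(x₀,x_t) ∼ q}[‖∇_{x_t} ln q(x_t|x₀)‖²] − E_{x_t ∼ q(x_t)}[‖∇_{x_t} ln q(x_t)‖²]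 does not depend on ψ. In particular, the two objectives have the same minimizers in ψ. -/
open MeasureTheory

lemma gradient_log {E : Type*} [NormedAddCommGroup E] [InnerProductSpace ℝ E]
    [CompleteSpace E] {f : E → ℝ} {x : E}
    (hf : DifferentiableAt ℝ f x)
    (hx : f x ≠ 0) : gradient (fun y => Real.log (f y)) x = (f x)⁻¹ • gradient f x := by
  simp [gradient, fderiv.log hf hx]

section

variable {E : Type*} [NormedAddCommGroup E] [InnerProductSpace ℝ E] [FiniteDimensional ℝ E]
  [MeasurableSpace E] [BorelSpace E]

/-- A measurable function has vanishing derivative almost everywhere on its zero set. -/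
lemma ae_fderiv_eq_zero_of_eq_zero (μ : Measure E) [μ.IsAddHaarMeasure] {f : E → ℝ}
    (hf : Measurable f) : ∀ᵐ x ∂μ, f x = 0 → fderiv ℝ f x = 0 := by
  rcases subsingleton_or_nontrivial E with hE | hE
  · exact .of_forall fun x _ => Subsingleton.elim _ _
  obtain ⟨e, he⟩ := exists_ne (0 : E)
  let s : Set E := {x | f x = 0} ∩ {x | DifferentiableAt ℝ f x}
  have hs : MeasurableSet s :=
    (hf (measurableSet_singleton 0)).inter (measurableSet_of_differentiableAt ℝ f)
  have happrox : ApproximatesLinearOn (fun x => f x • e) (0 : E →L[ℝ] E) s 0 := by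
    intro x hx y hy
    simp [show f x = 0 from hx.1, show f y = 0 from hy.1]
  have hae := happrox.norm_fderiv_sub_le μ hs (fun x => (fderiv ℝ f x).smulRight e)
    fun x hx => (hx.2.hasFDerivAt.smul_const e).hasFDerivWithinAt
  filter_upwards [(ae_restrict_iff' hs).1 hae] with x hx hx0
  by_cases hd : DifferentiableAt ℝ f x
  · simpa [he] using hx ⟨hx0, hd⟩
  · exact fderiv_zero_of_not_differentiableAt hd

lemma measurable_gradient (f : E → ℝ) : Measurable (gradient f) :=
  (InnerProductSpace.toDual ℝ E).symm.continuous.measurable.comp (measurable_fderiv ℝ f)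

lemma measurable_gradient_snd {α : Type*} [MeasurableSpace α] {q : α × E → ℝ}
    (hq : Measurable q) (hd : ∀ a, Differentiable ℝ fun y => q (a, y)) :
    Measurable fun z : α × E => gradient (fun y => q (z.1, y)) z.2 := by
  let b := stdOrthonormalBasis ℝ E
  have hcoord (v : E) : Measurable fun z : α × E => fderiv ℝ (fun y => q (z.1, y)) z.2 v := by
    refine measurable_of_tendsto_metrizable
      (f := fun (n : ℕ) z => (n : ℝ) • (q (z.1, z.2 + (n : ℝ)⁻¹ • v) - q (z.1, z.2))) ?_ ?_
    · intro n
      fun_prop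
    · refine tendsto_pi_nhds.2 fun z => ?_
      exact ((hd z.1 z.2).hasFDerivAt.lim_real v).comp tendsto_natCast_atTop_atTop
  have hsum : (fun z : α × E => gradient (fun y => q (z.1, y)) z.2) =
      fun z => ∑ i, fderiv ℝ (fun y => q (z.1, y)) z.2 (b i) • b i := by
    ext1 z
    rw [← b.sum_repr' (gradient (fun y => q (z.1, y)) z.2)]
    refine Finset.sum_congr rfl fun i _ => ?_
    rw [inner_gradient_right]
    simp
  rw [hsum]
  exact Finset.measurable_sum _ fun i _ => (hcoord (b i)).smul_const (b i)

/-- The identity `f ∇ log f = ∇ f` holds almost everywhere on `{f ≠ 0}`, even without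
differentiability of `f`. -/
lemma ae_smul_gradient_log (μ : Measure E) [μ.IsAddHaarMeasure] {f : E → ℝ}
    (hf : Measurable f) (hf0 : ∀ x, 0 ≤ f x) :
    ∀ᵐ x ∂μ, f x ≠ 0 → f x • gradient (fun y => Real.log (f y)) x = gradient f x := by
  filter_upwards [ae_fderiv_eq_zero_of_eq_zero μ hf.log] with x hx hfx
  by_cases hd : DifferentiableAt ℝ f x
  · rw [gradient_log hd hfx, smul_inv_smul₀ hfx]
  rw [gradient_eq_zero_of_not_differentiableAt hd]
  suffices h : fderiv ℝ (fun y => Real.log (f y)) x = 0 by simp [gradient, h]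
  by_cases hl : Real.log (f x) = 0
  · exact hx hl
  refine fderiv_zero_of_not_differentiableAt fun hld => hd ?_
  refine hld.exp.congr_of_eventuallyEq ?_
  filter_upwards [hld.continuousAt.eventually_ne hl] with y hy
  exact (Real.exp_log ((hf0 y).lt_of_ne fun h => hy (by simp [← h]))).symm

end

section

variable {α E : Type*} [MeasurableSpace α] [NormedAddCommGroup E] [InnerProductSpace ℝ E]
  {μ : Measure α} {w : α → ℝ} {a b : α → E}

lemma integrable_mul_inner (hw : AEStronglyMeasurable w μ) (hw0 : ∀ x, 0 ≤ w x)
    (ha : AEStronglyMeasurable a μ) (hb : AEStronglyMeasurable b μ)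
    (hwa : Integrable (fun x => w x * ‖a x‖ ^ 2) μ)
    (hwb : Integrable (fun x => w x * ‖b x‖ ^ 2) μ) :
    Integrable (fun x => w x * inner ℝ (a x) (b x)) μ := by
  refine (hwa.add hwb).mono' (hw.mul (ha.inner hb)) (.of_forall fun x => ?_)
  rw [norm_mul, Real.norm_of_nonneg (hw0 x), Pi.add_apply, ← mul_add]
  refine mul_le_mul_of_nonneg_left ((norm_inner_le_norm _ _).trans ?_) (hw0 x)
  nlinarith [sq_nonneg (‖a x‖ - ‖b x‖), sq_nonneg ‖a x‖, sq_nonneg ‖b x‖]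

lemma integral_mul_norm_sub_sq (hw : AEStronglyMeasurable w μ) (hw0 : ∀ x, 0 ≤ w x)
    (ha : AEStronglyMeasurable a μ) (hb : AEStronglyMeasurable b μ)
    (hwa : Integrable (fun x => w x * ‖a x‖ ^ 2) μ)
    (hwb : Integrable (fun x => w x * ‖b x‖ ^ 2) μ) :
    ∫ x, w x * ‖a x - b x‖ ^ 2 ∂μ =
      ∫ x, w x * ‖a x‖ ^ 2 ∂μ - 2 * ∫ x, w x * inner ℝ (a x) (b x) ∂μ +
        ∫ x, w x * ‖b x‖ ^ 2 ∂μ := by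
  have hab := (integrable_mul_inner hw hw0 ha hb hwa hwb).const_mul 2
  rw [← integral_const_mul, ← integral_sub hwa hab]
  refine Eq.trans ?_ (integral_add (hwa.sub hab) hwb)
  congr 1 with x
  simp only [norm_sub_sq_real]
  ring

end

/-- conditional Vincent denoising score-matching identity, Lemma 1.
Let `q` be a strictly positive probability density on `ℝ^d × ℝ^d` for a pair `(x₀, x_t)`,
with marginal `qt x_t = ∫ q (x₀, x_t) dx₀` and conditional density
`q(x_t|x₀) = q (x₀, x_t) / q₀ x₀` where `q₀ x₀ = ∫ q (x₀, x_t) dx_t`.  Assuming `q` is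
continuously differentiable in `x_t`, differentiation under the integral sign is valid for
`qt`, and both squared scores are integrable against `q`, then for every measurable
`ψ` with `E[‖ψ(x_t)‖²] < ∞`,
`E_{(x₀,x_t)∼q} ‖∇ ln q(x_t|x₀) − ψ(x_t)‖² = E_{x_t∼qt} ‖∇ ln qt(x_t) − ψ(x_t)‖² + C`
where `C = E ‖∇ ln q(x_t|x₀)‖² − E ‖∇ ln qt(x_t)‖²` does not depend on `ψ`. -/
theorem conditional_denoising_score_matching_identity
    (d : ℕ)
    (q : EuclideanSpace ℝ (Fin d) × EuclideanSpace ℝ (Fin d) → ℝ)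
    (hq_meas : Measurable q)
    (hq_pos : ∀ z, 0 < q z)
    (hq_int : Integrable q)
    (hq_prob : ∫ z, q z = 1)
    (hq_diff : ∀ x0, ContDiff ℝ 1 (fun xt => q (x0, xt)))
    (qt : EuclideanSpace ℝ (Fin d) → ℝ)
    (hqt : ∀ xt, qt xt = ∫ x0, q (x0, xt))
    (q0 : EuclideanSpace ℝ (Fin d) → ℝ)
    (hq0 : ∀ x0, q0 x0 = ∫ xt, q (x0, xt))
    -- differentiation under the integral sign for the marginal density
    (hswap : ∀ xt, gradient qt xt = ∫ x0, gradient (fun y => q (x0, y)) xt)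
    -- integrability of the squared conditional score against q
    (hint_cond : Integrable (fun z : EuclideanSpace ℝ (Fin d) × EuclideanSpace ℝ (Fin d) =>
        q z * ‖gradient (fun y => Real.log (q (z.1, y) / q0 z.1)) z.2‖ ^ 2))
    -- integrability of the squared marginal score against qt
    (hint_marg : Integrable (fun xt =>
        qt xt * ‖gradient (fun y => Real.log (qt y)) xt‖ ^ 2)) :
    ∀ ψ : EuclideanSpace ℝ (Fin d) → EuclideanSpace ℝ (Fin d), Measurable ψ →
      Integrable (fun xt => qt xt * ‖ψ xt‖ ^ 2) →
      (∫ z : EuclideanSpace ℝ (Fin d) × EuclideanSpace ℝ (Fin d),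
          q z * ‖gradient (fun y => Real.log (q (z.1, y) / q0 z.1)) z.2 - ψ z.2‖ ^ 2)
        = (∫ xt, qt xt * ‖gradient (fun y => Real.log (qt y)) xt - ψ xt‖ ^ 2)
          + ((∫ z : EuclideanSpace ℝ (Fin d) × EuclideanSpace ℝ (Fin d),
              q z * ‖gradient (fun y => Real.log (q (z.1, y) / q0 z.1)) z.2‖ ^ 2)
            - ∫ xt, qt xt * ‖gradient (fun y => Real.log (qt y)) xt‖ ^ 2) := by
  intro ψ hψ hψ_int
  have hq_nonneg (z) : 0 ≤ q z := (hq_pos z).le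
  have hqt_eq : qt = fun xt => ∫ x0, q (x0, xt) := funext hqt
  have hqt_meas : Measurable qt :=
    hqt_eq ▸ hq_meas.stronglyMeasurable.integral_prod_left'.measurable
  have hqt_nonneg (xt) : 0 ≤ qt xt := hqt xt ▸ integral_nonneg fun _ => hq_nonneg _
  have hpos {f : EuclideanSpace ℝ (Fin d) → ℝ} (hf : ∀ x, 0 < f x) (hfi : Integrable f) :
      0 < ∫ x, f x := by
    rw [integral_pos_iff_support_of_nonneg (fun x => (hf x).le) hfi,
      Function.support_eq_univ fun x => (hf x).ne']
    exact Measure.measure_univ_pos.2 (NeZero.ne _)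
  have hqt_ne : ∀ᵐ xt, qt xt ≠ 0 := by
    filter_upwards [Integrable.prod_left_ae hq_int] with xt h
    exact hqt xt ▸ (hpos (fun _ => hq_pos _) h).ne'
  have hq0_ne : ∀ᵐ z : EuclideanSpace ℝ (Fin d) × EuclideanSpace ℝ (Fin d), q0 z.1 ≠ 0 := by
    have h : ∀ᵐ x0, q0 x0 ≠ 0 := by
      filter_upwards [Integrable.prod_right_ae hq_int] with x0 h
      exact hq0 x0 ▸ (hpos (fun _ => hq_pos _) h).ne'
    exact Measure.quasiMeasurePreserving_fst.ae h
  have hd (x0) : Differentiable ℝ fun y => q (x0, y) := (hq_diff x0).differentiable one_ne_zero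
  let G : EuclideanSpace ℝ (Fin d) × EuclideanSpace ℝ (Fin d) → EuclideanSpace ℝ (Fin d) :=
    fun z => gradient (fun y => q (z.1, y)) z.2
  let S : EuclideanSpace ℝ (Fin d) × EuclideanSpace ℝ (Fin d) → EuclideanSpace ℝ (Fin d) :=
    fun z => gradient (fun y => Real.log (q (z.1, y) / q0 z.1)) z.2
  let T : EuclideanSpace ℝ (Fin d) → EuclideanSpace ℝ (Fin d) := gradient fun y => Real.log (qt y)
  have hG_meas : Measurable G := measurable_gradient_snd hq_meas hd
  have hS_ae : S =ᵐ[volume] fun z => (q z)⁻¹ • G z := by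
    filter_upwards [hq0_ne] with z hz
    have hfun : (fun y => Real.log (q (z.1, y) / q0 z.1)) =
        fun y => Real.log (q (z.1, y)) - Real.log (q0 z.1) :=
      funext fun y => Real.log_div (hq_pos _).ne' hz
    have hlog := gradient_log (hd z.1 z.2) (hq_pos (z.1, z.2)).ne'
    simp only [S, G]
    rw [hfun, ← hlog]
    simp only [gradient, fderiv_sub_const]
  have hS_meas : AEStronglyMeasurable S :=
    (hq_meas.inv.smul hG_meas).aestronglyMeasurable.congr hS_ae.symm
  have hT_meas : AEStronglyMeasurable T := (measurable_gradient _).aestronglyMeasurable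
  have hqS : (fun z => q z • S z) =ᵐ[volume] G := by
    filter_upwards [hS_ae] with z hz
    rw [hz, smul_inv_smul₀ (hq_pos z).ne']
  have hG_int : Integrable G := by
    refine (hq_int.add hint_cond).mono' hG_meas.aestronglyMeasurable ?_
    filter_upwards [hqS] with z hz
    rw [← hz, norm_smul, Real.norm_of_nonneg (hq_nonneg z)]
    change q z * ‖S z‖ ≤ q z + q z * ‖S z‖ ^ 2
    nlinarith [hq_pos z, mul_nonneg (hq_nonneg z) (sq_nonneg (‖S z‖ - 1)),
      mul_nonneg (hq_nonneg z) (sq_nonneg ‖S z‖)]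
  have hqT : ∀ᵐ xt, qt xt • T xt = ∫ x0, G (x0, xt) := by
    filter_upwards [hqt_ne, ae_smul_gradient_log volume hqt_meas hqt_nonneg] with xt h0 h
    exact (h h0).trans (hswap xt)
  have hψ2 : Measurable fun z : EuclideanSpace ℝ (Fin d) × EuclideanSpace ℝ (Fin d) => ψ z.2 :=
    hψ.comp measurable_snd
  have hsec (xt : EuclideanSpace ℝ (Fin d)) :
      ∫ x0, q (x0, xt) * ‖ψ xt‖ ^ 2 = qt xt * ‖ψ xt‖ ^ 2 := by
    rw [integral_mul_const, hqt]
  have hqψ_int : Integrable fun z : EuclideanSpace ℝ (Fin d) × EuclideanSpace ℝ (Fin d) =>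
      q z * ‖ψ z.2‖ ^ 2 := by
    have hmeas : Measurable fun z : EuclideanSpace ℝ (Fin d) × EuclideanSpace ℝ (Fin d) =>
        q z * ‖ψ z.2‖ ^ 2 :=
      hq_meas.mul (hψ2.norm.pow_const 2)
    refine (integrable_prod_iff' hmeas.aestronglyMeasurable).2 ⟨?_, ?_⟩
    · filter_upwards [Integrable.prod_left_ae hq_int] with xt h
      exact h.mul_const _
    · refine hψ_int.congr (.of_forall fun xt => ?_)
      simp only [← hsec, Real.norm_of_nonneg (mul_nonneg (hq_nonneg _) (sq_nonneg ‖ψ xt‖))]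
  have hqψ : ∫ z : EuclideanSpace ℝ (Fin d) × EuclideanSpace ℝ (Fin d),
      q z * ‖ψ z.2‖ ^ 2 = ∫ xt, qt xt * ‖ψ xt‖ ^ 2 :=
    (integral_prod_symm _ hqψ_int).trans (integral_congr_ae (.of_forall hsec))
  have hcross_int : Integrable fun z : EuclideanSpace ℝ (Fin d) × EuclideanSpace ℝ (Fin d) =>
      q z * inner ℝ (S z) (ψ z.2) :=
    integrable_mul_inner hq_meas.aestronglyMeasurable hq_nonneg hS_meas
      hψ2.aestronglyMeasurable hint_cond hqψ_int
  have hcross_ae : (fun z : EuclideanSpace ℝ (Fin d) × EuclideanSpace ℝ (Fin d) =>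
      q z * inner ℝ (S z) (ψ z.2)) =ᵐ[volume]
      fun z => inner ℝ (ψ z.2) (G z) := by
    filter_upwards [hqS] with z hz
    rw [← hz, real_inner_smul_right, real_inner_comm]
  have hcross : ∫ z : EuclideanSpace ℝ (Fin d) × EuclideanSpace ℝ (Fin d),
      q z * inner ℝ (S z) (ψ z.2) =
      ∫ xt, qt xt * inner ℝ (T xt) (ψ xt) := by
    rw [integral_congr_ae hcross_ae]
    refine (integral_prod_symm _ (hcross_int.congr hcross_ae)).trans (integral_congr_ae ?_)
    filter_upwards [Integrable.prod_left_ae hG_int, hqT] with xt hxt hT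
    rw [integral_inner hxt, ← hT, real_inner_smul_right, real_inner_comm]
  have hcond := integral_mul_norm_sub_sq hq_meas.aestronglyMeasurable hq_nonneg hS_meas
    hψ2.aestronglyMeasurable hint_cond hqψ_int
  have hmarg := integral_mul_norm_sub_sq hqt_meas.aestronglyMeasurable hqt_nonneg hT_meas
    hψ.aestronglyMeasurable hint_marg hψ_int
  rw [hcross, hqψ] at hcond
  simp only [S, T] at hcond hmarg
  rw [hcond, hmarg]
  ring
end

section
/- Let f : ℝ → ℝ be measurable with |f(y)| ≤ M for all y and Lipschitz continuous with Lipschitz constant L > 0, and let σ > 0. Then for every y ∈ ℝ and every ε > 0, |(f ∗ φ_σ)(y) − f(y)| ≤ ε + 4M exp(−ε² / (2 L² σ²)), where (f ∗ φ_σ)(y) = ∫ f(z) φ_σ(y − z) dz. -/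
open MeasureTheory

/-- The density of the centered Gaussian distribution on `ℝ` with variance `σ²`. -/
noncomputable def gaussPDF (σ x : ℝ) : ℝ :=
  (Real.sqrt (2 * Real.pi * σ ^ 2))⁻¹ * Real.exp (-x ^ 2 / (2 * σ ^ 2))

namespace ProbabilityTheory

open scoped NNReal

theorem hasSubgaussianMGF_id_gaussianReal (v : ℝ≥0) :
    HasSubgaussianMGF id v (gaussianReal 0 v) where
  integrable_exp_mul t := integrable_exp_mul_gaussianReal t
  mgf_le t := by simp [mgf_id_gaussianReal]

/-- The two-sided Chernoff bound for a Gaussian distribution. -/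
theorem gaussianReal_real_abs_sub_ge_le (m : ℝ) (v : ℝ≥0) {a : ℝ} (ha : 0 ≤ a) :
    (gaussianReal m v).real {z | a ≤ |z - m|} ≤ 2 * Real.exp (-a ^ 2 / (2 * v)) := by
  have hX : HasSubgaussianMGF (fun z ↦ z - m) v (gaussianReal m v) := by
    have h := hasSubgaussianMGF_id_gaussianReal v
    rw [← sub_self m, ← gaussianReal_map_sub_const] at h
    exact HasSubgaussianMGF.of_map (by fun_prop) h
  have h₁ := hX.measure_ge_le ha
  have h₂ := hX.neg.measure_ge_le ha
  have hunion : {z : ℝ | a ≤ |z - m|} = {z | a ≤ z - m} ∪ {z | a ≤ (-fun z ↦ z - m) z} := by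
    ext z
    simp [le_abs]
  rw [hunion, two_mul]
  exact (measureReal_union_le _ _).trans (add_le_add h₁ h₂)

end ProbabilityTheory

theorem gaussPDF_sub_eq_gaussianPDFReal (σ y z : ℝ) :
    gaussPDF σ (y - z) = ProbabilityTheory.gaussianPDFReal y (σ ^ 2).toNNReal z := by
  rw [gaussPDF, ProbabilityTheory.gaussianPDFReal, Real.coe_toNNReal _ (sq_nonneg σ),
    ← neg_sub z y, neg_sq]

open ProbabilityTheory in
theorem integral_mul_gaussPDF_sub (f : ℝ → ℝ) {σ : ℝ} (hσ : σ ≠ 0) (y : ℝ) :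
    ∫ z, f z * gaussPDF σ (y - z) = ∫ z, f z ∂gaussianReal y (σ ^ 2).toNNReal := by
  have hv : (σ ^ 2).toNNReal ≠ 0 := by
    simpa using hσ
  simp [integral_gaussianReal_eq_integral_smul hv, gaussPDF_sub_eq_gaussianPDFReal, mul_comm]

/-- quantitative estimate from the proof of Lemma 5.
If `f` is measurable, bounded by `M` and `L`-Lipschitz, then for every `y` and every
`ε > 0`, `|(f ∗ φ_σ)(y) − f(y)| ≤ ε + 4M exp(−ε²/(2L²σ²))`. -/
theorem gaussian_mollification_quantitative_bound
    (f : ℝ → ℝ) (M L σ : ℝ) (hL : 0 < L) (hσ : 0 < σ)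
    (hf_meas : Measurable f)
    (hf_bdd : ∀ y, |f y| ≤ M)
    (hf_lip : ∀ a b, |f a - f b| ≤ L * |a - b|) :
    ∀ y ε : ℝ, 0 < ε →
      |(∫ z : ℝ, f z * gaussPDF σ (y - z)) - f y|
        ≤ ε + 4 * M * Real.exp (-ε ^ 2 / (2 * L ^ 2 * σ ^ 2)) := by
  intro y ε hε
  have hM : 0 ≤ M := (abs_nonneg _).trans (hf_bdd y)
  rw [integral_mul_gaussPDF_sub f hσ.ne']
  set ν := ProbabilityTheory.gaussianReal y (σ ^ 2).toNNReal
  set S : Set ℝ := {z | ε / L ≤ |z - y|}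
  have hS_meas : MeasurableSet S := measurableSet_le (by fun_prop) (by fun_prop)
  have hf_int : Integrable f ν :=
    .of_bound hf_meas.aestronglyMeasurable M (.of_forall hf_bdd)
  have hbound (z : ℝ) : ‖f z - f y‖ ≤ ε + S.indicator (fun _ ↦ 2 * M) z := by
    rw [Real.norm_eq_abs]
    by_cases hz : z ∈ S
    · rw [Set.indicator_of_mem hz]
      linarith [abs_sub (f z) (f y), hf_bdd z, hf_bdd y]
    · rw [Set.indicator_of_notMem hz, add_zero]
      have hz' : |z - y| < ε / L := not_le.mp hz
      exact (hf_lip z y).trans ((lt_div_iff₀' hL).mp hz').le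
  have hind_int : Integrable (S.indicator fun _ ↦ 2 * M) ν :=
    (integrable_const _).indicator hS_meas
  have htail : ν.real S ≤ 2 * Real.exp (-ε ^ 2 / (2 * L ^ 2 * σ ^ 2)) := by
    convert ProbabilityTheory.gaussianReal_real_abs_sub_ge_le y (σ ^ 2).toNNReal
      (div_pos hε hL).le using 3
    rw [Real.coe_toNNReal _ (sq_nonneg σ)]
    field_simp
  calc |(∫ z, f z ∂ν) - f y| = ‖∫ z, (f z - f y) ∂ν‖ := by
        rw [integral_sub hf_int (integrable_const _)]
        simp
    _ ≤ ∫ z, (ε + S.indicator (fun _ ↦ 2 * M) z) ∂ν :=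
        norm_integral_le_of_norm_le ((integrable_const _).add hind_int) (.of_forall hbound)
    _ = ε + ν.real S * (2 * M) := by
        rw [integral_add (integrable_const _) hind_int, integral_indicator_const _ hS_meas]
        simp
    _ ≤ ε + 2 * Real.exp (-ε ^ 2 / (2 * L ^ 2 * σ ^ 2)) * (2 * M) := by gcongr
    _ = ε + 4 * M * Real.exp (-ε ^ 2 / (2 * L ^ 2 * σ ^ 2)) := by ring
end
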